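/- Let N ≥ 2 and ε ∈ (0,1]. If ε > 1/√(2^{N−1} + 1), then the noisy GHZ state ρ_ε = ε |GHZ_N⟩⟨GHZ_N| + (1−ε) I/2^N on (ℂ²)^{⊗N} is not fully separable, i.e. it cannot be written as a convex combination Σ_i p_i ρ_i^{(1)} ⊗ ⋯ ⊗ ρ_i^{(N)} of product states. -/

import Mathlib

open Matrix
open scoped ComplexOrder

/-- The `N`-qubit GHZ state `(|0…0⟩ + |1…1⟩)/√2`. -/
noncomputable def ghz (N : ℕ) : (Fin N → Fin 2) → ℂ :=
  fun a => if a = (fun _ => 0) then (1 / Real.sqrt 2 : ℝ)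
    else if a = (fun _ => 1) then (1 / Real.sqrt 2 : ℝ) else 0

lemma Matrix.PosSemidef.norm_sq_apply_le {ι : Type*} {A : Matrix ι ι ℂ} (hA : A.PosSemidef)
    (i j : ι) : ‖A i j‖ ^ 2 ≤ (A i i).re * (A j j).re := by
  have hdet := (hA.submatrix ![i, j]).det_nonneg
  have hi := Complex.nonneg_iff.mp (hA.diag_nonneg (i := i))
  have hj := Complex.nonneg_iff.mp (hA.diag_nonneg (i := j))
  have hji : A j i = star (A i j) := (hA.isHermitian.apply j i).symm
  rw [det_fin_two] at hdet
  have hre := (Complex.nonneg_iff.mp hdet).1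
  simp [hji, ← hi.2, ← hj.2] at hre
  rw [Complex.sq_norm, Complex.normSq_apply]
  linarith

lemma Matrix.PosSemidef.re_diag_nonneg {ι : Type*} {A : Matrix ι ι ℂ} (hA : A.PosSemidef)
    (i : ι) : 0 ≤ (A i i).re :=
  (Complex.nonneg_iff.mp (hA.diag_nonneg (i := i))).1

lemma Matrix.PosSemidef.ofReal_re_diag {ι : Type*} {A : Matrix ι ι ℂ} (hA : A.PosSemidef)
    (i : ι) : ((A i i).re : ℂ) = A i i :=
  Complex.ext rfl (Complex.nonneg_iff.mp (hA.diag_nonneg (i := i))).2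

/-- The extreme off-diagonal entry of a product state is bounded by the mean of any two diagonal
entries at complementary bit strings. -/
lemma two_mul_norm_prod_le {κ : Type*} [Fintype κ] {σ : κ → Matrix (Fin 2) (Fin 2) ℂ}
    (hσ : ∀ n, (σ n).PosSemidef) (a : κ → Fin 2) :
    2 * ‖∏ n, σ n 0 1‖ ≤
      (∏ n, σ n (a n) (a n)).re + (∏ n, σ n (1 - a n) (1 - a n)).re := by
  have hre (b : κ → Fin 2) :
      (∏ n, σ n (b n) (b n)).re = ∏ n, (σ n (b n) (b n)).re := by
    rw [← Complex.ofReal_re (∏ n, (σ n (b n) (b n)).re), Complex.ofReal_prod]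
    simp_rw [(hσ _).ofReal_re_diag]
  have hpos (b : κ → Fin 2) : 0 ≤ ∏ n, (σ n (b n) (b n)).re :=
    Finset.prod_nonneg fun n _ => (hσ n).re_diag_nonneg _
  have hsq : ‖∏ n, σ n 0 1‖ ^ 2 ≤
      (∏ n, (σ n (a n) (a n)).re) * ∏ n, (σ n (1 - a n) (1 - a n)).re := by
    rw [norm_prod, ← Finset.prod_pow, ← Finset.prod_mul_distrib]
    refine Finset.prod_le_prod (fun n _ => by positivity) fun n _ => ?_
    have h := (hσ n).norm_sq_apply_le 0 1
    generalize a n = c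
    fin_cases c
    · simpa using h
    · simpa [mul_comm] using h
  rw [hre a, hre fun n => 1 - a n]
  refine abs_le_of_sq_le_sq' ?_ (add_nonneg (hpos a) (hpos fun n => 1 - a n)) |>.2
  nlinarith [sq_nonneg ((∏ n, (σ n (a n) (a n)).re) - ∏ n, (σ n (1 - a n) (1 - a n)).re)]

/-- If `ε > 1/√(2^{N-1}+1)` then the noisy GHZ state
`ρ_ε = ε |GHZ⟩⟨GHZ| + (1-ε) I/2^N` is not fully separable, i.e. it is not a
convex combination of tensor products of single-qubit density matrices. -/
theorem noisy_ghz_entangled {N : ℕ} (hN : 2 ≤ N) (ε : ℝ) (hε0 : 0 < ε) (hε1 : ε ≤ 1)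
    (hε : 1 / Real.sqrt (2 ^ (N - 1) + 1) < ε) :
    ¬ ∃ (m : ℕ) (p : Fin m → ℝ) (σ : Fin m → Fin N → Matrix (Fin 2) (Fin 2) ℂ),
        (∀ i, 0 ≤ p i) ∧ (∑ i, p i = 1) ∧
        (∀ i n, (σ i n).PosSemidef) ∧ (∀ i n, (σ i n).trace = 1) ∧
        (ε : ℂ) • Matrix.vecMulVec (ghz N) (star (ghz N)) +
            ((1 : ℂ) - ε) • ((2 : ℂ) ^ N)⁻¹ • 1
          = ∑ i, (p i : ℂ) • Matrix.of fun a b => ∏ n, σ i n (a n) (b n) := by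
  rintro ⟨m, p, σ, hp, -, hσ, -, h⟩
  obtain ⟨k, rfl⟩ : ∃ k, N = k + 2 := ⟨N - 2, by omega⟩
  have hentry (a b : Fin (k + 2) → Fin 2) := congrFun (congrFun h a) b
  simp only [Matrix.add_apply, Matrix.smul_apply, Matrix.sum_apply, vecMulVec_apply,
    Matrix.of_apply, smul_eq_mul, Pi.star_apply] at hentry
  have h01 : (fun _ => 0 : Fin (k + 2) → Fin 2) ≠ fun _ => 1 :=
    fun h => zero_ne_one (congrFun h 0)
  have hoff : ∑ i, (p i : ℂ) * ∏ n, σ i n 0 1 = ((ε / 2 : ℝ) : ℂ) := by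
    rw [← hentry (fun _ => 0) fun _ => 1]
    have hs : ((Real.sqrt 2 : ℂ))⁻¹ * (Real.sqrt 2 : ℂ)⁻¹ = 1 / 2 := by
      rw [← mul_inv, ← Complex.ofReal_mul, Real.mul_self_sqrt (by norm_num)]
      norm_num
    simp [ghz, h01, h01.symm, hs]
    ring
  have hdiag (a : Fin (k + 2) → Fin 2) (ha : a 0 ≠ a 1) :
      ∑ i, p i * (∏ n, σ i n (a n) (a n)).re = (1 - ε) / 2 ^ (k + 2) := by
    have h0 : a ≠ fun _ => 0 := by rintro rfl; exact ha rfl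
    have h1 : a ≠ fun _ => 1 := by rintro rfl; exact ha rfl
    have hc : ((1 : ℂ) - ε) * ((2 : ℂ) ^ (k + 2))⁻¹ =
        (((1 - ε) / 2 ^ (k + 2) : ℝ) : ℂ) := by push_cast; rfl
    have := hentry a a
    rw [show ghz (k + 2) a = 0 by simp [ghz, h0, h1], Matrix.one_apply_eq, mul_one, hc] at this
    have hre := congrArg Complex.re this
    rw [zero_mul, mul_zero, zero_add, Complex.ofReal_re,
      Complex.re_sum] at hre
    simpa only [Complex.re_ofReal_mul] using hre.symm
  let a : Fin (k + 2) → Fin 2 := fun n => if n = 0 then 0 else 1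
  have hbound : 2 * (ε / 2) ≤ (1 - ε) / 2 ^ (k + 2) + (1 - ε) / 2 ^ (k + 2) := by
    calc 2 * (ε / 2) = 2 * ‖∑ i, (p i : ℂ) * ∏ n, σ i n 0 1‖ := by
          rw [hoff, Complex.norm_real, Real.norm_of_nonneg (by positivity)]
      _ ≤ 2 * ∑ i, p i * ‖∏ n, σ i n 0 1‖ := by
          gcongr
          refine (norm_sum_le _ _).trans_eq (Finset.sum_congr rfl fun i _ => ?_)
          rw [norm_mul, Complex.norm_real, Real.norm_of_nonneg (hp i)]
      _ = ∑ i, p i * (2 * ‖∏ n, σ i n 0 1‖) := by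
          rw [Finset.mul_sum]
          exact Finset.sum_congr rfl fun i _ => by ring
      _ ≤ ∑ i, p i * ((∏ n, σ i n (a n) (a n)).re +
            (∏ n, σ i n (1 - a n) (1 - a n)).re) :=
          Finset.sum_le_sum fun i _ =>
            mul_le_mul_of_nonneg_left (two_mul_norm_prod_le (hσ i) a) (hp i)
      _ = _ := by
          simp_rw [mul_add]
          rw [Finset.sum_add_distrib, hdiag a (by simp [a]),
            hdiag (fun n => 1 - a n) (by simp [a])]
  have hM : (0 : ℝ) < 2 ^ (k + 1) := by positivity
  have hle : ε * (2 ^ (k + 1) + 1) ≤ 1 := by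
    rw [← add_div, le_div_iff₀ (by positivity), pow_succ _ (k + 1)] at hbound
    linarith
  rw [show k + 2 - 1 = k + 1 by omega, div_lt_iff₀ (by positivity)] at hε
  have hsqrt : Real.sqrt (2 ^ (k + 1) + 1) ≤ 2 ^ (k + 1) + 1 :=
    Real.sqrt_le_self_iff.mpr (Or.inr (by linarith))
  nlinarith [mul_le_mul_of_nonneg_left hsqrt hε0.le]
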